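/- arXiv:1703.00100 — 13 statements merged into one kernel-verified Lean document; each statement's English description precedes it below -/
import Mathlib

section
/- Let θ0, θ1, θ∞, η ∈ ℂ with θ1 ≠ 0, and set ε := (θ0+θ∞+η)/2, α := θ∞²/2, β := −θ0²/2, γ := −θ1·(η+1), δ := −θ1²/2. Let U ⊆ ℂ be open and let y, z : U → ℂ be holomorphic functions satisfying the Hamiltonian system associated with PV on U, with y(t) ∉ {0, 1} for all t ∈ U. Then y satisfies PVlog(α,β,γ,δ) on U, i.e. y'' = (1/(2y) + 1/(y−1))·(y')² + (y−1)²·(α·y + β/y) + γ·e^t·y + δ·e^{2t}·y·(y+1)/(y−1). -/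
/-- Holomorphic solutions `(y, z)` of the Hamiltonian system associated with
`PV`, with `y` avoiding `0` and `1`, yield solutions `y` of `PVlog(α,β,γ,δ)` with
`α = θ∞²/2`, `β = −θ0²/2`, `γ = −θ1(η+1)`, `δ = −θ1²/2`. -/
theorem stmt_1 (θ0 θ1 θinf η : ℂ) (hθ1 : θ1 ≠ 0)
    (U : Set ℂ) (hU : IsOpen U)
    (y z : ℂ → ℂ) (hy : DifferentiableOn ℂ y U) (hz : DifferentiableOn ℂ z U)
    (hy0 : ∀ t ∈ U, y t ≠ 0) (hy1 : ∀ t ∈ U, y t ≠ 1)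
    (hsys1 : ∀ t ∈ U, deriv y t =
      2 * y t * (y t - 1) ^ 2 * z t - (θ0 + η) * (y t) ^ 2
        + (2 * θ0 + η - θ1 * Complex.exp t) * y t - θ0)
    (hsys2 : ∀ t ∈ U, deriv z t =
      -((y t - 1) * (3 * y t - 1) * (z t) ^ 2)
        + (2 * (θ0 + η) * y t - 2 * θ0 - η + θ1 * Complex.exp t) * z t
        - (1 / 2) * ((θ0 + θinf + η) / 2) * (θ0 + η - θinf)) :
    ∀ t ∈ U, deriv (deriv y) t =
      (1 / (2 * y t) + 1 / (y t - 1)) * (deriv y t) ^ 2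
        + (y t - 1) ^ 2 * ((θinf ^ 2 / 2) * y t + (-(θ0 ^ 2) / 2) / y t)
        + (-(θ1 * (η + 1))) * Complex.exp t * y t
        + (-(θ1 ^ 2) / 2) * Complex.exp (2 * t) * y t * (y t + 1) / (y t - 1) := by
  intro t ht
  have hUt := hU.mem_nhds ht
  have hyd := (hy.differentiableAt hUt).hasDerivAt
  have hzd := (hz.differentiableAt hUt).hasDerivAt
  have hexp := Complex.hasDerivAt_exp t
  have hrhs := (((((hyd.const_mul 2).mul ((hyd.sub_const 1).pow 2)).mul hzd).sub
    ((hyd.pow 2).const_mul (θ0 + η))).add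
    (((hexp.const_mul θ1).const_sub (2 * θ0 + η)).mul hyd)).sub_const θ0
  have hderiv := (hrhs.congr_of_eventuallyEq (Filter.mem_of_superset hUt hsys1)).deriv
  have h0 := hy0 t ht
  have h1 : y t - 1 ≠ 0 := sub_ne_zero.mpr (hy1 t ht)
  have hexp2 : Complex.exp (2 * t) = Complex.exp t ^ 2 := by
    rw [two_mul, Complex.exp_add, sq]
  rw [hderiv, hexp2, hsys2 t ht, hsys1 t ht]
  simp only [Pi.mul_apply, Pi.pow_apply]
  generalize y t = Y at *
  generalize z t = Z at *
  generalize Complex.exp t = E at *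
  field_simp
  ring
end

section
/- Let θ0, θ1, θ∞, η ∈ ℂ with ε := (θ0+θ∞+η)/2, and let E(y,z) := y(y−1)²z² − (θ0+η)y²z + (2θ0+η)yz − θ0·z + (1/2)·ε·(θ0+η−θ∞)·y. Let U ⊆ ℂ be open and let y, z : U → ℂ be holomorphic functions satisfying the Hamiltonian system associated with PV on U. Then for all t ∈ U, the derivative of t ↦ E(y(t), z(t)) equals −θ1·e^t·( z(t)·( 2θ0 − (η+2θ0)·y(t) + 2y(t)(y(t)−1)·z(t) ) + E(y(t), z(t)) ). -/
/-- Along holomorphic solutions `(y, z)` of the Hamiltonian system associated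
with `PV`, the energy `E(y,z)` satisfies
`E' = −θ1·e^t·( z·(2θ0 − (η+2θ0)y + 2y(y−1)z) + E )`. -/
theorem stmt_2 (θ0 θ1 θinf η : ℂ)
    (U : Set ℂ) (hU : IsOpen U)
    (y z : ℂ → ℂ) (hy : DifferentiableOn ℂ y U) (hz : DifferentiableOn ℂ z U)
    (hsys1 : ∀ t ∈ U, deriv y t =
      2 * y t * (y t - 1) ^ 2 * z t - (θ0 + η) * (y t) ^ 2
        + (2 * θ0 + η - θ1 * Complex.exp t) * y t - θ0)
    (hsys2 : ∀ t ∈ U, deriv z t =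
      -((y t - 1) * (3 * y t - 1) * (z t) ^ 2)
        + (2 * (θ0 + η) * y t - 2 * θ0 - η + θ1 * Complex.exp t) * z t
        - (1 / 2) * ((θ0 + θinf + η) / 2) * (θ0 + η - θinf)) :
    ∀ t ∈ U,
      deriv (fun s => y s * (y s - 1) ^ 2 * (z s) ^ 2 - (θ0 + η) * (y s) ^ 2 * z s
          + (2 * θ0 + η) * y s * z s - θ0 * z s
          + (1 / 2) * ((θ0 + θinf + η) / 2) * (θ0 + η - θinf) * y s) t =
        -(θ1 * Complex.exp t) *
          (z t * (2 * θ0 - (η + 2 * θ0) * y t + 2 * y t * (y t - 1) * z t)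
            + (y t * (y t - 1) ^ 2 * (z t) ^ 2 - (θ0 + η) * (y t) ^ 2 * z t
                + (2 * θ0 + η) * y t * z t - θ0 * z t
                + (1 / 2) * ((θ0 + θinf + η) / 2) * (θ0 + η - θinf) * y t)) := by
  intro t ht
  have hy' := (hy.differentiableAt (hU.mem_nhds ht)).hasDerivAt
  have hz' := (hz.differentiableAt (hU.mem_nhds ht)).hasDerivAt
  rw [hsys1 t ht] at hy'
  rw [hsys2 t ht] at hz'
  have hE := (((((hy'.fun_mul ((hy'.sub_const 1).fun_pow 2)).fun_mul (hz'.fun_pow 2)).fun_sub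
    (((hy'.fun_pow 2).const_mul (θ0 + η)).fun_mul hz')).fun_add
    ((hy'.const_mul (2 * θ0 + η)).fun_mul hz')).fun_sub (hz'.const_mul θ0)).fun_add
    (hy'.const_mul ((1 / 2) * ((θ0 + θinf + η) / 2) * (θ0 + η - θinf)))
  rw [hE.deriv]
  norm_num
  ring
end

section
/- Let α, β ∈ ℂ, let U ⊆ ℂ be a nonempty open connected set, and let y : U → ℂ be holomorphic with y(t) ∉ {0, 1} for all t ∈ U, satisfying the autonomous equation y'' = (1/(2y) + 1/(y−1))·(y')² + (y−1)²·(α·y + β/y) on U. Then there exists a constant C ∈ ℂ such that for all t ∈ U, (y'(t))² = (y(t)−1)²·( 2α·y(t)² + C·y(t) − 2β ). -/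
/-- A holomorphic solution of the autonomous equation
`y'' = (1/(2y) + 1/(y−1))·(y')² + (y−1)²·(α·y + β/y)` on a nonempty open connected set,
avoiding the values `0` and `1`, satisfies the first integral
`(y')² = (y−1)²·(2α·y² + C·y − 2β)` for some constant `C`. -/
theorem stmt_3 (α β : ℂ) (U : Set ℂ) (hU : IsOpen U) (hUc : IsConnected U)
    (y : ℂ → ℂ) (hy : DifferentiableOn ℂ y U)
    (hy0 : ∀ t ∈ U, y t ≠ 0) (hy1 : ∀ t ∈ U, y t ≠ 1)
    (heq : ∀ t ∈ U, deriv (deriv y) t =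
      (1 / (2 * y t) + 1 / (y t - 1)) * (deriv y t) ^ 2
        + (y t - 1) ^ 2 * (α * y t + β / y t)) :
    ∃ C : ℂ, ∀ t ∈ U, (deriv y t) ^ 2 =
      (y t - 1) ^ 2 * (2 * α * (y t) ^ 2 + C * y t - 2 * β) := by
  have key : ∀ t ∈ U, HasDerivAt
      (fun s => deriv y s ^ 2 / (y s * (y s - 1) ^ 2) - 2 * α * y s + 2 * β / y s) 0 t := by
    intro t ht
    have h0 := hy0 t ht
    have h1 : y t - 1 ≠ 0 := sub_ne_zero.2 (hy1 t ht)
    have hd : HasDerivAt y (deriv y t) t := (hy.differentiableAt (hU.mem_nhds ht)).hasDerivAt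
    have hdd : HasDerivAt (deriv y) (deriv (deriv y) t) t :=
      ((hy.deriv hU).differentiableAt (hU.mem_nhds ht)).hasDerivAt
    have hden : y t * (y t - 1) ^ 2 ≠ 0 := mul_ne_zero h0 (pow_ne_zero 2 h1)
    have h := (((hdd.pow 2).div (hd.mul ((hd.sub_const 1).pow 2)) hden).sub
      (hd.const_mul (2 * α))).add ((hasDerivAt_const t (2 * β)).div hd h0)
    refine h.congr_deriv ?_
    simp only [Pi.pow_apply, Pi.mul_apply]
    rw [heq t ht]
    field_simp
    ring
  obtain ⟨C, hC⟩ := hU.exists_is_const_of_deriv_eq_zero hUc.isPreconnected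
    (fun t ht => (key t ht).differentiableAt.differentiableWithinAt)
    (fun t ht => (key t ht).deriv)
  refine ⟨C, fun t ht => ?_⟩
  have h0 := hy0 t ht
  have h1 : y t - 1 ≠ 0 := sub_ne_zero.2 (hy1 t ht)
  rw [← hC t ht]
  field_simp
  ring
end

section
/- Let θ0, θ1, η ∈ ℂ with θ1 ≠ 0, and let α ∈ ℂ satisfy (θ0+η)² = 2α. Let U ⊆ ℂ be open and let y : U → ℂ be holomorphic with y(t) ∉ {0, 1} for all t ∈ U, satisfying the Riccati equation y' = −(θ0+η)·y² + (2θ0+η−θ1·e^t)·y − θ0 on U. Then y satisfies PVlog(α, β, γ, δ) on U with β = −θ0²/2, γ = −θ1·(η+1), δ = −θ1²/2. -/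
/-- Solutions of the Riccati equation
`y' = −(θ0+η)·y² + (2θ0+η−θ1·e^t)·y − θ0` avoiding `0` and `1` satisfy
`PVlog(α, −θ0²/2, −θ1(η+1), −θ1²/2)` where `(θ0+η)² = 2α`. -/
theorem stmt_7 (θ0 θ1 η α : ℂ) (hθ1 : θ1 ≠ 0) (hα : (θ0 + η) ^ 2 = 2 * α)
    (U : Set ℂ) (hU : IsOpen U) (y : ℂ → ℂ) (hy : DifferentiableOn ℂ y U)
    (hy0 : ∀ t ∈ U, y t ≠ 0) (hy1 : ∀ t ∈ U, y t ≠ 1)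
    (hric : ∀ t ∈ U, deriv y t =
      -(θ0 + η) * (y t) ^ 2 + (2 * θ0 + η - θ1 * Complex.exp t) * y t - θ0) :
    ∀ t ∈ U, deriv (deriv y) t =
      (1 / (2 * y t) + 1 / (y t - 1)) * (deriv y t) ^ 2
        + (y t - 1) ^ 2 * (α * y t + (-(θ0 ^ 2) / 2) / y t)
        + (-(θ1 * (η + 1))) * Complex.exp t * y t
        + (-(θ1 ^ 2) / 2) * Complex.exp (2 * t) * y t * (y t + 1) / (y t - 1) := by
  intro t ht
  have hyt : HasDerivAt y (deriv y t) t := (hy.differentiableAt (hU.mem_nhds ht)).hasDerivAt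
  have heq : deriv y =ᶠ[nhds t] fun s =>
      -(θ0 + η) * (y s) ^ 2 + (2 * θ0 + η - θ1 * Complex.exp s) * y s - θ0 :=
    Filter.eventually_of_mem (hU.mem_nhds ht) hric
  have hderiv := (((hyt.pow 2).const_mul (-(θ0 + η))).add
    ((((Complex.hasDerivAt_exp t).const_mul θ1).const_sub (2 * θ0 + η)).mul hyt)).sub_const θ0
  have hsecond : deriv (deriv y) t =
      -(θ0 + η) * (2 * y t * deriv y t) + (-(θ1 * Complex.exp t) * y t
        + (2 * θ0 + η - θ1 * Complex.exp t) * deriv y t) := by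
    rw [heq.deriv_eq]
    refine Eq.trans hderiv.deriv ?_
    norm_num
  have hexp : Complex.exp (2 * t) = Complex.exp t ^ 2 := by
    rw [← Complex.exp_nat_mul]; norm_num
  have hne0 := hy0 t ht
  have hne1 : y t - 1 ≠ 0 := sub_ne_zero.mpr (hy1 t ht)
  have hα' : α = (θ0 + η) ^ 2 / 2 := by rw [hα]; ring
  rw [hsecond, hric t ht, hexp, hα']
  field_simp
  ring
end

section
/- Let θ0, θ1 ∈ ℂ with θ1 ≠ 0. Let U ⊆ ℂ be open and let y : U → ℂ be holomorphic with y(t) ∉ {0, 1} for all t ∈ U, satisfying the Riccati equation y' = θ0·y² − (2θ0 + θ1·e^t)·y + θ0 on U. Then y satisfies PVlog(α, β, γ, δ) on U with α = θ0²/2, β = −θ0²/2, γ = −θ1, δ = −θ1²/2. -/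
/-- Solutions of the Riccati equation
`y' = θ0·y² − (2θ0 + θ1·e^t)·y + θ0` avoiding `0` and `1` satisfy
`PVlog(θ0²/2, −θ0²/2, −θ1, −θ1²/2)`. -/
theorem stmt_8 (θ0 θ1 : ℂ) (hθ1 : θ1 ≠ 0)
    (U : Set ℂ) (hU : IsOpen U) (y : ℂ → ℂ) (hy : DifferentiableOn ℂ y U)
    (hy0 : ∀ t ∈ U, y t ≠ 0) (hy1 : ∀ t ∈ U, y t ≠ 1)
    (hric : ∀ t ∈ U, deriv y t =
      θ0 * (y t) ^ 2 - (2 * θ0 + θ1 * Complex.exp t) * y t + θ0) :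
    ∀ t ∈ U, deriv (deriv y) t =
      (1 / (2 * y t) + 1 / (y t - 1)) * (deriv y t) ^ 2
        + (y t - 1) ^ 2 * ((θ0 ^ 2 / 2) * y t + (-(θ0 ^ 2) / 2) / y t)
        + (-θ1) * Complex.exp t * y t
        + (-(θ1 ^ 2) / 2) * Complex.exp (2 * t) * y t * (y t + 1) / (y t - 1) := by
  intro t ht
  have hyt : HasDerivAt y (deriv y t) t :=
    (hy.differentiableAt (hU.mem_nhds ht)).hasDerivAt
  have heq : deriv y =ᶠ[nhds t] fun s =>
      θ0 * (y s) ^ 2 - (2 * θ0 + θ1 * Complex.exp s) * y s + θ0 :=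
    Filter.eventually_of_mem (hU.mem_nhds ht) hric
  have hderiv := ((((hyt.pow 2).const_mul θ0).sub
    ((((Complex.hasDerivAt_exp t).const_mul θ1).const_add (2 * θ0)).mul hyt)).add_const
      θ0).congr_of_eventuallyEq heq
  have h0 := hy0 t ht
  have h1 : y t - 1 ≠ 0 := sub_ne_zero.mpr (hy1 t ht)
  have hexp : Complex.exp (2 * t) = Complex.exp t ^ 2 := by
    rw [two_mul, Complex.exp_add, sq]
  rw [hderiv.deriv, hric t ht, hexp]
  field_simp
  ring
end

section
/- Let κ, μ ∈ ℂ and define y : ℂ → ℂ by y(x) = κ·x + μ. Then at every x ∈ ℂ with x ≠ 0 and y(x) ∉ {0, 1}, the function y satisfies the fifth Painlevé equation PV(α,β,γ,δ) with α = 1/2, β = −μ²/2, γ = κ·(2−μ), δ = −κ²/2. -/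
/-- The linear function `y(x) = κ·x + μ` is a seed rational solution of
`PV(1/2, −μ²/2, κ(2−μ), −κ²/2)` at every `x ≠ 0` where `y(x) ∉ {0,1}`. -/
theorem stmt_9 (κ μ : ℂ) :
    ∀ x : ℂ, x ≠ 0 → κ * x + μ ≠ 0 → κ * x + μ ≠ 1 →
      deriv (deriv fun s => κ * s + μ) x =
        (1 / (2 * (κ * x + μ)) + 1 / (κ * x + μ - 1)) *
            (deriv (fun s => κ * s + μ) x) ^ 2
          - deriv (fun s => κ * s + μ) x / x
          + (κ * x + μ - 1) ^ 2 *
              ((1 / 2) * (κ * x + μ) + (-(μ ^ 2) / 2) / (κ * x + μ)) / x ^ 2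
          + (κ * (2 - μ)) * (κ * x + μ) / x
          + (-(κ ^ 2) / 2) * (κ * x + μ) * (κ * x + μ + 1) / (κ * x + μ - 1) := by
  intro x hx h0 h1
  have hderiv : (deriv fun s : ℂ => κ * s + μ) = fun _ => κ := by
    funext s
    simp
  have h1' : κ * x + μ - 1 ≠ 0 := sub_ne_zero.mpr h1
  rw [hderiv, deriv_const]
  field_simp
  ring
end

section
/- Let κ, μ ∈ ℂ and define y(x) = κ/(x+κ). Then at every x ∈ ℂ with x ≠ 0, x ≠ −κ, and y(x) ∉ {0, 1}, the function y satisfies the fifth Painlevé equation PV(α,β,γ,δ) with α = 1/2, β = κ²·μ, γ = 2κμ, δ = μ. -/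
/-- At the pole `s = -κ` both sides are zero. -/
theorem deriv_div_add_const (κ : ℂ) :
    deriv (fun s : ℂ => κ / (s + κ)) = fun s => -κ / (s + κ) ^ 2 := by
  funext s
  simp only [div_eq_mul_inv, deriv_const_mul_field']
  rw [deriv_comp_add_const (fun s : ℂ => s⁻¹), deriv_inv]
  ring

theorem hasDerivAt_neg_div_add_const_sq {κ x : ℂ} (h : x + κ ≠ 0) :
    HasDerivAt (fun s : ℂ => -κ / (s + κ) ^ 2) (2 * κ / (x + κ) ^ 3) x := by
  have hd := (hasDerivAt_const x (-κ)).fun_div (((hasDerivAt_id' x).add_const κ).fun_pow 2)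
    (pow_ne_zero 2 h)
  refine hd.congr_deriv ?_
  field_simp
  norm_num
  ring

/-- The function `y(x) = κ/(x+κ)` is a seed rational solution of
`PV(1/2, κ²μ, 2κμ, μ)` at every `x ∉ {0, −κ}` where `y(x) ∉ {0,1}`. -/
theorem stmt_10 (κ μ : ℂ) :
    ∀ x : ℂ, x ≠ 0 → x ≠ -κ → κ / (x + κ) ≠ 0 → κ / (x + κ) ≠ 1 →
      deriv (deriv fun s => κ / (s + κ)) x =
        (1 / (2 * (κ / (x + κ))) + 1 / (κ / (x + κ) - 1)) *
            (deriv (fun s => κ / (s + κ)) x) ^ 2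
          - deriv (fun s => κ / (s + κ)) x / x
          + (κ / (x + κ) - 1) ^ 2 *
              ((1 / 2) * (κ / (x + κ)) + (κ ^ 2 * μ) / (κ / (x + κ))) / x ^ 2
          + (2 * κ * μ) * (κ / (x + κ)) / x
          + μ * (κ / (x + κ)) * (κ / (x + κ) + 1) / (κ / (x + κ) - 1) := by
  intro x hx hxκ hy _
  have h : x + κ ≠ 0 := fun h => hxκ (eq_neg_of_add_eq_zero_left h)
  have hκ : κ ≠ 0 := fun h => hy (by simp [h])
  have hy1 : κ / (x + κ) - 1 = -x / (x + κ) := by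
    field_simp
    ring
  rw [deriv_div_add_const, (hasDerivAt_neg_div_add_const_sq h).deriv, hy1]
  field_simp
  ring
end

section
/- Let κ, μ ∈ ℂ and define y(x) = (κ+x)/(κ−x). Then at every x ∈ ℂ with x ≠ 0, x ≠ κ, and y(x) ∉ {0, 1}, the function y satisfies the fifth Painlevé equation PV(α,β,γ,δ) with α = 1/8, β = −1/8, γ = −κμ, δ = μ. -/
/-- The derivative of `s ↦ (κ+s)/(κ−s)` away from its pole. -/
theorem hasDerivAt_add_div_sub {κ x : ℂ} (hx : κ - x ≠ 0) :
    HasDerivAt (fun s => (κ + s) / (κ - s)) (2 * κ / (κ - x) ^ 2) x := by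
  refine (((hasDerivAt_id' x).const_add κ).div ((hasDerivAt_id' x).const_sub κ) hx).congr_deriv ?_
  ring

/-- The second derivative of `s ↦ (κ+s)/(κ−s)` away from its pole. -/
theorem deriv_deriv_add_div_sub {κ x : ℂ} (hx : κ - x ≠ 0) :
    deriv (deriv fun s => (κ + s) / (κ - s)) x = 4 * κ / (κ - x) ^ 3 := by
  have hev : deriv (fun s => (κ + s) / (κ - s)) =ᶠ[nhds x] fun s => 2 * κ / (κ - s) ^ 2 := by
    have hcont : ContinuousAt (fun s : ℂ => κ - s) x := by fun_prop
    filter_upwards [hcont.eventually_ne hx] with s hs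
    exact (hasDerivAt_add_div_sub hs).deriv
  rw [hev.deriv_eq]
  refine HasDerivAt.deriv ?_
  refine ((hasDerivAt_const x (2 * κ)).div (((hasDerivAt_id' x).const_sub κ).pow 2)
    (pow_ne_zero 2 hx)).congr_deriv ?_
  simp only [Pi.pow_apply]
  field_simp
  ring

/-- The function `y(x) = (κ+x)/(κ−x)` is a seed rational solution of
`PV(1/8, −1/8, −κμ, μ)` at every `x ∉ {0, κ}` where `y(x) ∉ {0,1}`. -/
theorem stmt_11 (κ μ : ℂ) :
    ∀ x : ℂ, x ≠ 0 → x ≠ κ → (κ + x) / (κ - x) ≠ 0 → (κ + x) / (κ - x) ≠ 1 →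
      deriv (deriv fun s => (κ + s) / (κ - s)) x =
        (1 / (2 * ((κ + x) / (κ - x))) + 1 / ((κ + x) / (κ - x) - 1)) *
            (deriv (fun s => (κ + s) / (κ - s)) x) ^ 2
          - deriv (fun s => (κ + s) / (κ - s)) x / x
          + ((κ + x) / (κ - x) - 1) ^ 2 *
              ((1 / 8) * ((κ + x) / (κ - x)) + (-(1 / 8)) / ((κ + x) / (κ - x))) / x ^ 2
          + (-(κ * μ)) * ((κ + x) / (κ - x)) / x
          + μ * ((κ + x) / (κ - x)) * ((κ + x) / (κ - x) + 1) /
              ((κ + x) / (κ - x) - 1) := by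
  intro x hx hxκ hy _
  have hd : κ - x ≠ 0 := sub_ne_zero.mpr hxκ.symm
  have hn : κ + x ≠ 0 := fun h => hy (by rw [h, zero_div])
  have hsub : (κ + x) / (κ - x) - 1 = 2 * x / (κ - x) := by
    field_simp
    ring
  rw [deriv_deriv_add_div_sub hd, (hasDerivAt_add_div_sub hd).deriv, hsub]
  field_simp
  ring
end

section
/- Let α, β, γ, δ ∈ ℂ, let V ⊆ ℂ ∖ {0} be open, and let y : V → ℂ be holomorphic with y(x) ∉ {0, 1} for all x ∈ V and satisfying the fifth Painlevé equation PV(α,β,γ,δ) on V. Define w on −V := {−x : x ∈ V} by w(x) = y(−x). Then w satisfies the fifth Painlevé equation PV(α, β, −γ, δ) on −V. -/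
/-- The Bäcklund transformation `S₁`: if `y` solves `PV(α,β,γ,δ)` on an open
set `V ⊆ ℂ ∖ {0}`, avoiding the values `0` and `1`, then `w(x) = y(−x)` solves
`PV(α,β,−γ,δ)` on `−V`. -/
theorem stmt_13 (α β γ δ : ℂ) (V : Set ℂ) (hV : IsOpen V) (hV0 : (0 : ℂ) ∉ V)
    (y : ℂ → ℂ) (hy : DifferentiableOn ℂ y V)
    (hy0 : ∀ x ∈ V, y x ≠ 0) (hy1 : ∀ x ∈ V, y x ≠ 1)
    (hPV : ∀ x ∈ V, deriv (deriv y) x =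
      (1 / (2 * y x) + 1 / (y x - 1)) * (deriv y x) ^ 2 - deriv y x / x
        + (y x - 1) ^ 2 * (α * y x + β / y x) / x ^ 2 + γ * y x / x
        + δ * y x * (y x + 1) / (y x - 1)) :
    ∀ x : ℂ, -x ∈ V →
      deriv (deriv fun s => y (-s)) x =
        (1 / (2 * y (-x)) + 1 / (y (-x) - 1)) * (deriv (fun s => y (-s)) x) ^ 2
          - deriv (fun s => y (-s)) x / x
          + (y (-x) - 1) ^ 2 * (α * y (-x) + β / y (-x)) / x ^ 2
          + (-γ) * y (-x) / x
          + δ * y (-x) * (y (-x) + 1) / (y (-x) - 1) := by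
  intro x hx
  have hd : deriv (fun s => y (-s)) = fun s => -deriv y (-s) :=
    funext fun s => deriv_comp_neg y s
  have hdd : deriv (deriv fun s => y (-s)) x = deriv (deriv y) (-x) := by
    rw [hd, deriv.fun_neg, deriv_comp_neg (deriv y) x, neg_neg]
  rw [hdd, hd, hPV (-x) hx]
  ring
end

section
/- Let α, β, γ, δ ∈ ℂ, let V ⊆ ℂ ∖ {0} be open, and let y : V → ℂ be holomorphic with y(x) ∉ {0, 1} for all x ∈ V and satisfying the fifth Painlevé equation PV(α,β,γ,δ) on V. Then the function w := 1/y satisfies the fifth Painlevé equation PV(−β, −α, −γ, δ) on V. -/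
/-- The Bäcklund transformation `S₂`: if `y` solves `PV(α,β,γ,δ)` on an open
set `V ⊆ ℂ ∖ {0}`, avoiding the values `0` and `1`, then `w = 1/y` solves
`PV(−β,−α,−γ,δ)` on `V`. -/
theorem stmt_14 (α β γ δ : ℂ) (V : Set ℂ) (hV : IsOpen V) (hV0 : (0 : ℂ) ∉ V)
    (y : ℂ → ℂ) (hy : DifferentiableOn ℂ y V)
    (hy0 : ∀ x ∈ V, y x ≠ 0) (hy1 : ∀ x ∈ V, y x ≠ 1)
    (hPV : ∀ x ∈ V, deriv (deriv y) x =
      (1 / (2 * y x) + 1 / (y x - 1)) * (deriv y x) ^ 2 - deriv y x / x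
        + (y x - 1) ^ 2 * (α * y x + β / y x) / x ^ 2 + γ * y x / x
        + δ * y x * (y x + 1) / (y x - 1)) :
    ∀ x ∈ V,
      deriv (deriv fun s => 1 / y s) x =
        (1 / (2 * (1 / y x)) + 1 / (1 / y x - 1)) * (deriv (fun s => 1 / y s) x) ^ 2
          - deriv (fun s => 1 / y s) x / x
          + (1 / y x - 1) ^ 2 * ((-β) * (1 / y x) + (-α) / (1 / y x)) / x ^ 2
          + (-γ) * (1 / y x) / x
          + δ * (1 / y x) * (1 / y x + 1) / (1 / y x - 1) := by
  intro x hx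
  have hw : ∀ z ∈ V, HasDerivAt (fun s => 1 / y s) (-deriv y z / y z ^ 2) z := fun z hz => by
    simpa only [one_div] using
      (hy.differentiableAt (hV.mem_nhds hz)).hasDerivAt.fun_inv (hy0 z hz)
  have hw_eq : deriv (fun s => 1 / y s) =ᶠ[nhds x] fun z => -deriv y z / y z ^ 2 := by
    filter_upwards [hV.mem_nhds hx] with z hz using (hw z hz).deriv
  have hyd : HasDerivAt y (deriv y x) x := (hy.differentiableAt (hV.mem_nhds hx)).hasDerivAt
  have hydd : HasDerivAt (deriv y) (deriv (deriv y) x) x :=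
    ((hy.deriv hV).differentiableAt (hV.mem_nhds hx)).hasDerivAt
  have hx0 : x ≠ 0 := fun h => hV0 (h ▸ hx)
  have hyx0 := hy0 x hx
  have hyx1 : y x - 1 ≠ 0 := sub_ne_zero.mpr (hy1 x hx)
  have hinv : 1 / y x - 1 = -(y x - 1) / y x := by
    field_simp
    ring
  rw [hw_eq.deriv_eq, (hw x hx).deriv,
    (hydd.fun_neg.fun_div (hyd.fun_pow 2) (pow_ne_zero 2 hyx0)).deriv, hPV x hx, hinv]
  generalize deriv y x = p
  field_simp
  ring
end

section
/- Let α, β, γ, δ ∈ ℂ with α ≠ 0, let τ ∈ ℂ, let D be an open disc centered at τ, and let y : D ∖ {τ} → ℂ be holomorphic, satisfying PVlog(α,β,γ,δ) at every t ∈ D ∖ {τ} with y(t) ∉ {0, 1}. Suppose y is meromorphic at τ with a pole at τ (i.e. |y(t)| → ∞ as t → τ). Then the pole is simple, and the residue r of y at τ satisfies 2α·r² = 1. -/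
/-- If `y = w⁻¹` on an open set where `w` is holomorphic and does not vanish, then the first two derivatives of `y`
are given by the quotient rule. -/
lemma deriv_and_deriv_deriv_of_eqOn_inv {y w : ℂ → ℂ} {U : Set ℂ} (hU : IsOpen U)
    (hw : DifferentiableOn ℂ w U) (hw0 : ∀ t ∈ U, w t ≠ 0) (hyw : ∀ t ∈ U, y t = (w t)⁻¹)
    {t : ℂ} (ht : t ∈ U) :
    deriv y t = -deriv w t / w t ^ 2 ∧
      deriv (deriv y) t = 2 * deriv w t ^ 2 / w t ^ 3 - deriv (deriv w) t / w t ^ 2 := by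
  have hd : ∀ s ∈ U, deriv y s = -deriv w s / w s ^ 2 := fun s hs => by
    have hev : y =ᶠ[nhds s] fun u => (w u)⁻¹ := by
      filter_upwards [hU.mem_nhds hs] with u hu using hyw u hu
    rw [hev.deriv_eq]
    exact ((hw.differentiableAt (hU.mem_nhds hs)).hasDerivAt.fun_inv (hw0 s hs)).deriv
  refine ⟨hd t ht, ?_⟩
  have hev : deriv y =ᶠ[nhds t] fun s => -deriv w s / w s ^ 2 := by
    filter_upwards [hU.mem_nhds ht] with u hu using hd u hu
  rw [hev.deriv_eq]
  have h1 := (hw.differentiableAt (hU.mem_nhds ht)).hasDerivAt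
  have h2 := ((hw.deriv hU).differentiableAt (hU.mem_nhds ht)).hasDerivAt
  have h0 := hw0 t ht
  rw [(h2.fun_neg.fun_div (h1.fun_pow 2) (pow_ne_zero 2 h0)).deriv]
  push_cast
  field_simp
  ring

/-- If `‖y‖ → ∞` at an isolated singularity `τ`, then `y⁻¹`, extended by `0`, is analytic
at `τ`. -/
lemma analyticAt_update_inv_of_tendsto_norm_atTop {y : ℂ → ℂ} {τ : ℂ}
    (hy : ∀ᶠ t in nhdsWithin τ {τ}ᶜ, DifferentiableAt ℂ y t)
    (hpole : Filter.Tendsto (fun t => ‖y t‖) (nhdsWithin τ {τ}ᶜ) Filter.atTop) :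
    AnalyticAt ℂ (Function.update (fun t => (y t)⁻¹) τ 0) τ := by
  apply Complex.analyticAt_of_differentiable_on_punctured_nhds_of_continuousAt
  · filter_upwards [hy, hpole.eventually_gt_atTop 0, self_mem_nhdsWithin] with t ht h0 hne
    have hev : Function.update (fun t => (y t)⁻¹) τ 0 =ᶠ[nhds t] fun t => (y t)⁻¹ := by
      filter_upwards [isOpen_ne.mem_nhds hne] with u hu using Function.update_of_ne hu _ _
    exact (ht.fun_inv (norm_pos_iff.mp h0)).congr_of_eventuallyEq hev
  · rw [continuousAt_update_same]
    exact Filter.tendsto_inv₀_cobounded.comp (tendsto_norm_atTop_iff_cobounded.mp hpole)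

/-- A solution of `PVlog(α,β,γ,δ)` (with `α ≠ 0`) which is holomorphic on a
punctured disc around `τ` and has a pole at `τ` has a simple pole there, and its residue
`r` satisfies `2α·r² = 1`. -/
theorem stmt_15 (α β γ δ : ℂ) (hα : α ≠ 0) (τ : ℂ) (R : ℝ) (hR : 0 < R)
    (y : ℂ → ℂ) (hy : DifferentiableOn ℂ y (Metric.ball τ R \ {τ}))
    (hPV : ∀ t ∈ Metric.ball τ R \ {τ}, y t ≠ 0 → y t ≠ 1 →
      deriv (deriv y) t =
        (1 / (2 * y t) + 1 / (y t - 1)) * (deriv y t) ^ 2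
          + (y t - 1) ^ 2 * (α * y t + β / y t)
          + γ * Complex.exp t * y t
          + δ * Complex.exp (2 * t) * y t * (y t + 1) / (y t - 1))
    (hpole : Filter.Tendsto (fun t => ‖y t‖) (nhdsWithin τ {τ}ᶜ) Filter.atTop) :
    ∃ r : ℂ,
      Filter.Tendsto (fun t => (t - τ) * y t) (nhdsWithin τ {τ}ᶜ) (nhds r) ∧
      2 * α * r ^ 2 = 1 := by
  have hopen : IsOpen (Metric.ball τ R \ {τ}) := Metric.isOpen_ball.sdiff isClosed_singleton
  have hmem : ∀ᶠ t in nhdsWithin τ {τ}ᶜ, t ∈ Metric.ball τ R \ {τ} :=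
    sdiff_mem_nhdsWithin_compl (Metric.ball_mem_nhds τ hR) _
  have hdiff : ∀ᶠ t in nhdsWithin τ {τ}ᶜ, DifferentiableAt ℂ y t :=
    hmem.mono fun t ht => hy.differentiableAt (hopen.mem_nhds ht)
  have hw := analyticAt_update_inv_of_tendsto_norm_atTop hdiff hpole
  set w := Function.update (fun t => (y t)⁻¹) τ 0
  have hwτ : w τ = 0 := Function.update_self _ _ _
  have hwne : ∀ t ≠ τ, w t = (y t)⁻¹ := fun t ht => Function.update_of_ne ht _ _
  obtain ⟨ρ, hρ, hball⟩ := Metric.eventually_nhds_iff_ball.mp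
    (hw.eventually_analyticAt.and (eventually_nhdsWithin_iff.mp
      (hmem.and (hpole.eventually_gt_atTop 1))))
  have hUopen : IsOpen (Metric.ball τ ρ \ {τ}) := Metric.isOpen_ball.sdiff isClosed_singleton
  have hode : ∀ t ∈ Metric.ball τ ρ \ {τ},
      2 * deriv w t ^ 2 - w t * deriv (deriv w) t =
        (1 / 2 + 1 / (1 - w t)) * deriv w t ^ 2 + (1 - w t) ^ 2 * (α + β * w t ^ 2)
          + γ * Complex.exp t * w t ^ 2
          + δ * Complex.exp (2 * t) * w t ^ 2 * (1 + w t) / (1 - w t) := by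
    intro t ht
    have hy1 : ∀ s ∈ Metric.ball τ ρ \ {τ}, 1 < ‖y s‖ := fun s hs => ((hball s hs.1).2 hs.2).2
    have hy0 : ∀ s ∈ Metric.ball τ ρ \ {τ}, y s ≠ 0 := fun s hs =>
      norm_pos_iff.mp (one_pos.trans (hy1 s hs))
    have hyt : y t ≠ 1 := fun h => by simpa [h] using hy1 t ht
    have hyw : ∀ s ∈ Metric.ball τ ρ \ {τ}, y s = (w s)⁻¹ := fun s hs => by
      rw [hwne s hs.2, inv_inv]
    have hw0 : ∀ s ∈ Metric.ball τ ρ \ {τ}, w s ≠ 0 := fun s hs => by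
      rw [hwne s hs.2]
      exact inv_ne_zero (hy0 s hs)
    obtain ⟨h1, h2⟩ := deriv_and_deriv_deriv_of_eqOn_inv hUopen
      (fun s hs => (hball s hs.1).1.differentiableAt.differentiableWithinAt) hw0 hyw ht
    have h := hPV t ((hball t ht.1).2 ht.2).1 (hy0 t ht) hyt
    have h0 := hw0 t ht
    have hw1 : 1 - w t ≠ 0 := fun h' => hyt <| by
      rw [hyw t ht, ← sub_eq_zero.mp h', inv_one]
    have hsub : (w t)⁻¹ - 1 = (1 - w t) / w t := by field_simp
    rw [h1, h2, hyw t ht, hsub] at h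
    field_simp at h ⊢
    linear_combination h
  have hw' := hw.deriv.continuousAt
  have hw'' := hw.deriv.deriv.continuousAt
  have hwc := hw.continuousAt
  have hsq : deriv w τ ^ 2 = 2 * α := by
    have h1τ : 1 - w τ ≠ 0 := by simp [hwτ]
    have hL : ContinuousAt (fun t => 2 * deriv w t ^ 2 - w t * deriv (deriv w) t) τ := by
      fun_prop
    have hRt : ContinuousAt (fun t =>
        (1 / 2 + 1 / (1 - w t)) * deriv w t ^ 2 + (1 - w t) ^ 2 * (α + β * w t ^ 2)
          + γ * Complex.exp t * w t ^ 2
          + δ * Complex.exp (2 * t) * w t ^ 2 * (1 + w t) / (1 - w t)) τ := by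
      fun_prop (disch := assumption)
    have hlim := tendsto_nhds_unique_of_eventuallyEq
      (hL.tendsto.mono_left nhdsWithin_le_nhds) (hRt.tendsto.mono_left nhdsWithin_le_nhds)
      (Filter.mem_of_superset
        (sdiff_mem_nhdsWithin_compl (Metric.ball_mem_nhds τ hρ) {τ}) hode)
    simp only [hwτ] at hlim
    linear_combination 2 * hlim
  have hd : deriv w τ ≠ 0 := fun h => by simp [h, hα] at hsq
  refine ⟨(deriv w τ)⁻¹, ?_, ?_⟩
  · refine ((hasDerivAt_iff_tendsto_slope.mp hw.differentiableAt.hasDerivAt).inv₀ hd).congr' ?_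
    filter_upwards [self_mem_nhdsWithin] with t ht
    rw [slope_def_field, hwτ, sub_zero, hwne t ht, inv_div, div_inv_eq_mul]
  · rw [← hsq, inv_pow, mul_inv_cancel₀ (pow_ne_zero 2 hd)]
end

section
/- Let α, β, γ, δ ∈ ℂ, let U ⊆ ℂ be a nonempty open connected set, and let y : U → ℂ be a nonconstant holomorphic function satisfying PVlog(α,β,γ,δ) at every t ∈ U with y(t) ∉ {0, 1}. If y(τ) = 0 for some τ ∈ U, then (y'(τ))² = −2β. -/
/-- If a nonconstant holomorphic function `y` on a nonempty open connected
set `U` satisfies `PVlog(α,β,γ,δ)` at every point where `y ∉ {0,1}` and `y(τ) = 0` for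
some `τ ∈ U`, then `(y'(τ))² = −2β`. -/
theorem stmt_16 (α β γ δ : ℂ) (U : Set ℂ) (hU : IsOpen U) (hUc : IsConnected U)
    (y : ℂ → ℂ) (hy : DifferentiableOn ℂ y U)
    (hnc : ¬∃ k : ℂ, ∀ t ∈ U, y t = k)
    (hPV : ∀ t ∈ U, y t ≠ 0 → y t ≠ 1 →
      deriv (deriv y) t =
        (1 / (2 * y t) + 1 / (y t - 1)) * (deriv y t) ^ 2
          + (y t - 1) ^ 2 * (α * y t + β / y t)
          + γ * Complex.exp t * y t
          + δ * Complex.exp (2 * t) * y t * (y t + 1) / (y t - 1))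
    (τ : ℂ) (hτ : τ ∈ U) (hyτ : y τ = 0) :
    (deriv y τ) ^ 2 = -2 * β := by
  have hyU : AnalyticOnNhd ℂ y U := hy.analyticOnNhd hU
  have h0 : ContinuousAt y τ := (hyU τ hτ).continuousAt
  have h1 : ContinuousAt (deriv y) τ := (hyU τ hτ).deriv.continuousAt
  have h2 : ContinuousAt (deriv (deriv y)) τ := (hyU τ hτ).deriv.deriv.continuousAt
  have hzero : ∀ᶠ t in nhdsWithin τ {τ}ᶜ, y t ≠ 0 := by
    rcases (hyU τ hτ).eventually_eq_zero_or_eventually_ne_zero with h | h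
    · exact absurd ⟨0, hyU.eqOn_zero_of_preconnected_of_eventuallyEq_zero
        hUc.isPreconnected hτ h⟩ hnc
    · exact h
  have hone : ∀ᶠ t in nhdsWithin τ {τ}ᶜ, y t ≠ 1 :=
    (h0.eventually_ne (by simp [hyτ])).filter_mono nhdsWithin_le_nhds
  have hmem : ∀ᶠ t in nhdsWithin τ {τ}ᶜ, t ∈ U :=
    nhdsWithin_le_nhds (hU.mem_nhds hτ)
  -- `PVlog` with the denominators cleared
  let F : ℂ → ℂ := fun t => 2 * y t * (y t - 1) * deriv (deriv y) t
  let G : ℂ → ℂ := fun t => (y t - 1 + 2 * y t) * (deriv y t) ^ 2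
    + 2 * (y t - 1) ^ 3 * (α * y t ^ 2 + β)
    + 2 * γ * Complex.exp t * y t ^ 2 * (y t - 1)
    + 2 * δ * Complex.exp (2 * t) * y t ^ 2 * (y t + 1)
  have hFG : F =ᶠ[nhdsWithin τ {τ}ᶜ] G := by
    filter_upwards [hzero, hone, hmem] with t ht0 ht1 htU
    have ht1' : y t - 1 ≠ 0 := sub_ne_zero.mpr ht1
    simp only [F, G, hPV t htU ht0 ht1]
    field_simp
  have hF : ContinuousAt F τ := by fun_prop
  have hG : ContinuousAt G τ := by fun_prop
  have hlim : F τ = G τ := tendsto_nhds_unique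
    ((hF.tendsto.mono_left nhdsWithin_le_nhds).congr' hFG)
    (hG.tendsto.mono_left nhdsWithin_le_nhds)
  simp only [F, G, hyτ] at hlim
  linear_combination hlim
end

section
/- Let α, β, γ, δ ∈ ℂ, let U ⊆ ℂ be a nonempty open connected set, and let y : U → ℂ be a nonconstant holomorphic function satisfying PVlog(α,β,γ,δ) at every t ∈ U with y(t) ∉ {0, 1}. If y(τ) = 1 for some τ ∈ U, then (y'(τ))² = −2δ·e^{2τ}. -/
/-- If a nonconstant holomorphic function `y` on a nonempty open connected
set `U` satisfies `PVlog(α,β,γ,δ)` at every point where `y ∉ {0,1}` and `y(τ) = 1` for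
some `τ ∈ U`, then `(y'(τ))² = −2δ·e^{2τ}`. -/
theorem stmt_17 (α β γ δ : ℂ) (U : Set ℂ) (hU : IsOpen U) (hUc : IsConnected U)
    (y : ℂ → ℂ) (hy : DifferentiableOn ℂ y U)
    (hnc : ¬∃ k : ℂ, ∀ t ∈ U, y t = k)
    (hPV : ∀ t ∈ U, y t ≠ 0 → y t ≠ 1 →
      deriv (deriv y) t =
        (1 / (2 * y t) + 1 / (y t - 1)) * (deriv y t) ^ 2
          + (y t - 1) ^ 2 * (α * y t + β / y t)
          + γ * Complex.exp t * y t
          + δ * Complex.exp (2 * t) * y t * (y t + 1) / (y t - 1))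
    (τ : ℂ) (hτ : τ ∈ U) (hyτ : y τ = 1) :
    (deriv y τ) ^ 2 = -2 * δ * Complex.exp (2 * τ) := by
  have hana : AnalyticOnNhd ℂ y U := hy.analyticOnNhd hU
  have hyc : ContinuousAt y τ := (hana τ hτ).continuousAt
  have hdc : ContinuousAt (deriv y) τ := (hana τ hτ).deriv.continuousAt
  have hddc : ContinuousAt (deriv (deriv y)) τ := (hana τ hτ).deriv.deriv.continuousAt
  have hy0 : y τ ≠ 0 := by rw [hyτ]; exact one_ne_zero
  have hne_one : ∀ᶠ t in nhdsWithin τ {τ}ᶜ, y t ≠ 1 := by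
    by_contra h
    exact hnc ⟨1, hana.eqOn_of_preconnected_of_frequently_eq analyticOnNhd_const
      hUc.isPreconnected hτ ((Filter.not_eventually.mp h).mono fun _ ↦ not_not.mp)⟩
  have hne_zero : ∀ᶠ t in nhdsWithin τ {τ}ᶜ, y t ≠ 0 :=
    (hyc.eventually_ne hy0).filter_mono nhdsWithin_le_nhds
  have hmem : ∀ᶠ t in nhdsWithin τ {τ}ᶜ, t ∈ U :=
    Filter.Eventually.filter_mono nhdsWithin_le_nhds (hU.mem_nhds hτ)
  let F : ℂ → ℂ := fun t => (y t - 1) * deriv (deriv y) t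
  let G : ℂ → ℂ := fun t =>
    ((y t - 1) / (2 * y t) + 1) * (deriv y t) ^ 2
      + (y t - 1) ^ 3 * (α * y t + β / y t)
      + (y t - 1) * (γ * Complex.exp t * y t)
      + δ * Complex.exp (2 * t) * y t * (y t + 1)
  have hF : ContinuousAt F τ := by fun_prop
  have hG : ContinuousAt G τ := by
    have h2 : 2 * y τ ≠ 0 := mul_ne_zero two_ne_zero hy0
    fun_prop (disch := assumption)
  have hFG : F =ᶠ[nhdsWithin τ {τ}ᶜ] G := by
    filter_upwards [hne_one, hne_zero, hmem] with t h1 h0 ht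
    have h1' : y t - 1 ≠ 0 := sub_ne_zero.mpr h1
    simp only [F, G, hPV t ht h0 h1]
    field_simp
  have heq : F τ = G τ := tendsto_nhds_unique (hF.tendsto.mono_left nhdsWithin_le_nhds)
    ((hG.tendsto.mono_left nhdsWithin_le_nhds).congr' hFG.symm)
  simp only [F, G, hyτ] at heq
  linear_combination -heq
end
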